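/- Let m ≥ 0 and n ≥ 1 be integers and let λ > π be real. Then 1/π = ([∏_{k=1}^{m+n} (2k−1)]² · λ^{2m+2} / ((2m+1)! · 2^{4m+2n+1})) · ∫_0^∞ x^{2m+1} · J_{2m+2}(λx) / (Γ(m+n+1/2+x)·Γ(m+n+1/2−x)) dx. -/

import Mathlib

open MeasureTheory Real

/-- Bessel function of the first kind of nonnegative integer order `n`. -/
noncomputable def besselJ (n : ℕ) (x : ℝ) : ℝ :=
  ∑' k : ℕ, (-1 : ℝ) ^ k / (Nat.factorial k * Nat.factorial (n + k)) * (x / 2) ^ (n + 2 * k)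

open Filter Topology
open scoped ContDiff

/-- The entire function `E_n` with `J_n(x) = (x / 2) ^ n * E_n((x / 2) ^ 2)`. -/
noncomputable def besselE (n : ℕ) (y : ℝ) : ℝ :=
  ∑' k : ℕ, (-1 : ℝ) ^ k / (Nat.factorial k * Nat.factorial (n + k)) * y ^ k

lemma abs_besselE_term_le (n k : ℕ) (y : ℝ) :
    ‖(-1 : ℝ) ^ k / (Nat.factorial k * Nat.factorial (n + k)) * y ^ k‖
      ≤ |y| ^ k / Nat.factorial k := by
  have h1 : (1 : ℝ) ≤ Nat.factorial (n + k) := by exact_mod_cast Nat.factorial_pos _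
  have h2 : (0 : ℝ) < Nat.factorial k := by exact_mod_cast Nat.factorial_pos _
  rw [norm_mul, norm_div, norm_pow, norm_pow, norm_neg, norm_one, one_pow, Real.norm_eq_abs,
    Real.norm_eq_abs, abs_of_pos (by positivity), div_mul_eq_mul_div, one_mul]
  gcongr
  nlinarith

lemma summable_besselE_term (n : ℕ) (y : ℝ) :
    Summable fun k : ℕ =>
      (-1 : ℝ) ^ k / (Nat.factorial k * Nat.factorial (n + k)) * y ^ k :=
  Summable.of_norm_bounded (Real.summable_pow_div_factorial |y|) fun k =>
    abs_besselE_term_le n k y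

lemma besselJ_eq_besselE (n : ℕ) (x : ℝ) :
    besselJ n x = (x / 2) ^ n * besselE n ((x / 2) ^ 2) := by
  rw [besselJ, besselE, ← tsum_mul_left]
  refine tsum_congr fun k => ?_
  rw [pow_add, pow_mul]
  ring

lemma hasDerivAt_besselE (n : ℕ) (y : ℝ) : HasDerivAt (besselE n) (-besselE (n + 1) y) y := by
  set B : ℝ := |y| + 1 with hB
  have hterm : ∀ k : ℕ, ∀ z : ℝ,
      HasDerivAt (fun z : ℝ => (-1 : ℝ) ^ k / (Nat.factorial k * Nat.factorial (n + k)) * z ^ k)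
        ((-1 : ℝ) ^ k / (Nat.factorial k * Nat.factorial (n + k)) * (k * z ^ (k - 1))) z :=
    fun k z => (hasDerivAt_pow k z).const_mul _
  have hshift : ∀ (k : ℕ) (z : ℝ),
      (-1 : ℝ) ^ (k + 1) / (Nat.factorial (k + 1) * Nat.factorial (n + (k + 1)))
        * ((k + 1 : ℕ) * z ^ (k + 1 - 1))
      = -((-1 : ℝ) ^ k / (Nat.factorial k * Nat.factorial (n + 1 + k)) * z ^ k) := by
    intro k z
    have h2 : (Nat.factorial k : ℝ) ≠ 0 := by exact_mod_cast Nat.factorial_ne_zero _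
    have h3 : (Nat.factorial (n + 1 + k) : ℝ) ≠ 0 := by exact_mod_cast Nat.factorial_ne_zero _
    have h4 : ((k : ℝ) + 1) ≠ 0 := by positivity
    rw [show n + (k + 1) = n + 1 + k by ring, Nat.factorial_succ k, Nat.add_sub_cancel]
    push_cast
    field_simp
    ring
  let u : ℕ → ℝ := fun k => Nat.casesOn k 0 fun j => B ^ j / Nat.factorial j
  have hu : Summable u := (summable_nat_add_iff 1).1 (Real.summable_pow_div_factorial B)
  have hbound : ∀ (k : ℕ) (z : ℝ), z ∈ Metric.ball (0 : ℝ) B →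
      ‖(-1 : ℝ) ^ k / (Nat.factorial k * Nat.factorial (n + k)) * (k * z ^ (k - 1))‖ ≤ u k := by
    intro k z hz
    cases k with
    | zero => simp [u]
    | succ j =>
      rw [hshift, norm_neg]
      refine (abs_besselE_term_le _ _ _).trans ?_
      simp only [u]
      have : |z| ≤ B := by simpa using (Metric.mem_ball.1 hz).le
      gcongr
  have hy : y ∈ Metric.ball (0 : ℝ) B := by simp [hB]
  have key := hasDerivAt_tsum_of_isPreconnected hu Metric.isOpen_ball
    (convex_ball (0 : ℝ) B).isPreconnected (fun k z _ => hterm k z) hbound hy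
    (summable_besselE_term n y) hy
  refine key.congr_deriv ?_
  rw [Summable.tsum_eq_zero_add (Summable.of_norm_bounded hu fun k => hbound k y hy)]
  simp only [hshift, tsum_neg]
  simp [besselE]

lemma besselE_recurrence (n : ℕ) (y : ℝ) :
    besselE n y = (n + 1) * besselE (n + 1) y - y * besselE (n + 2) y := by
  have h1 := (summable_besselE_term (n + 1) y).mul_left ((n : ℝ) + 1)
  have h2 := (summable_besselE_term (n + 2) y).mul_left y
  rw [eq_sub_iff_add_eq]
  simp only [besselE]
  rw [← tsum_mul_left, ← tsum_mul_left, Summable.tsum_eq_zero_add (summable_besselE_term n y),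
    h1.tsum_eq_zero_add, add_assoc,
    ← Summable.tsum_add ((summable_nat_add_iff 1).2 (summable_besselE_term n y)) h2]
  congr 1
  · have h3 : (Nat.factorial n : ℝ) ≠ 0 := by exact_mod_cast Nat.factorial_ne_zero _
    have h4 : ((n : ℝ) + 1) ≠ 0 := by positivity
    simp [Nat.factorial_succ]
    field_simp
  · refine tsum_congr fun k => ?_
    have h3 : (Nat.factorial k : ℝ) ≠ 0 := by exact_mod_cast Nat.factorial_ne_zero _
    have h4 : (Nat.factorial (n + 1 + k) : ℝ) ≠ 0 := by exact_mod_cast Nat.factorial_ne_zero _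
    have h5 : ((k : ℝ) + 1) ≠ 0 := by positivity
    have h6 : ((n : ℝ) + 1 + k + 1) ≠ 0 := by positivity
    rw [show n + (k + 1) = n + 1 + k by ring, show n + 2 + k = (n + 1 + k) + 1 by ring,
      show n + 1 + (k + 1) = (n + 1 + k) + 1 by ring, Nat.factorial_succ k,
      Nat.factorial_succ (n + 1 + k)]
    push_cast
    field_simp
    ring

lemma besselJ_recurrence (n : ℕ) (x : ℝ) :
    x * (besselJ n x + besselJ (n + 2) x) = 2 * (n + 1) * besselJ (n + 1) x := by
  simp only [besselJ_eq_besselE]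
  rw [besselE_recurrence n]
  ring

lemma hasDerivAt_besselE_half_sq (n : ℕ) (x : ℝ) :
    HasDerivAt (fun x : ℝ => besselE n ((x / 2) ^ 2))
      (-(besselE (n + 1) ((x / 2) ^ 2) * (x / 2))) x := by
  have h := (hasDerivAt_besselE n ((x / 2) ^ 2)).comp x (((hasDerivAt_id x).div_const 2).pow 2)
  refine h.congr_deriv ?_
  simp only [id_eq, Nat.cast_ofNat]
  ring

lemma hasDerivAt_besselJ_zero (x : ℝ) : HasDerivAt (besselJ 0) (-besselJ 1 x) x := by
  have h := hasDerivAt_besselE_half_sq 0 x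
  have e : besselJ 0 = fun x : ℝ => besselE 0 ((x / 2) ^ 2) := by
    funext x; simp [besselJ_eq_besselE]
  rw [e]
  refine h.congr_deriv ?_
  simp [besselJ_eq_besselE]
  ring

lemma hasDerivAt_besselJ_succ (n : ℕ) (x : ℝ) :
    HasDerivAt (besselJ (n + 1)) ((besselJ n x - besselJ (n + 2) x) / 2) x := by
  have e : besselJ (n + 1) = fun x : ℝ => (x / 2) ^ (n + 1) * besselE (n + 1) ((x / 2) ^ 2) := by
    funext x; simp [besselJ_eq_besselE]
  rw [e]
  have h := (((hasDerivAt_id x).div_const 2).pow (n + 1)).mul (hasDerivAt_besselE_half_sq (n + 1) x)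
  refine h.congr_deriv ?_
  simp only [besselJ_eq_besselE]
  rw [besselE_recurrence n]
  simp
  ring

lemma continuous_besselJ (n : ℕ) : Continuous (besselJ n) := by
  refine continuous_iff_continuousAt.2 fun x => ?_
  cases n with
  | zero => exact (hasDerivAt_besselJ_zero x).continuousAt
  | succ n => exact (hasDerivAt_besselJ_succ n x).continuousAt

lemma besselJ_zero_zero : besselJ 0 0 = 1 := by
  rw [besselJ_eq_besselE, besselE, tsum_eq_single 0]
  · simp
  · intro k hk; simp [hk]

/-- An energy estimate for the Bessel equation of order `0`. -/
lemma exists_besselJ_energy_le :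
    ∃ C : ℝ, 0 ≤ C ∧ ∀ x : ℝ, 1 ≤ x → x * (besselJ 0 x ^ 2 + besselJ 1 x ^ 2) ≤ C := by
  set D : ℝ → ℝ := fun x =>
    x * (besselJ 0 x ^ 2 + besselJ 1 x ^ 2) - besselJ 0 x * besselJ 1 x with hD
  have hlow : ∀ x : ℝ, 1 ≤ x → x * (besselJ 0 x ^ 2 + besselJ 1 x ^ 2) ≤ 2 * D x := by
    intro x hx
    simp only [hD]
    nlinarith [sq_nonneg (besselJ 0 x - besselJ 1 x), sq_nonneg (besselJ 0 x),
      sq_nonneg (besselJ 1 x)]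
  have hderiv : ∀ x : ℝ, 1 ≤ x → HasDerivAt D (besselJ 0 x * besselJ 1 x / x) x := by
    intro x hx
    have h0 := hasDerivAt_besselJ_zero x
    have h1 := hasDerivAt_besselJ_succ 0 x
    have hrec := besselJ_recurrence 0 x
    have hx0 : x ≠ 0 := by positivity
    refine (((hasDerivAt_id x).mul ((h0.pow 2).add (h1.pow 2))).sub (h0.mul h1)).congr_deriv ?_
    norm_num at hrec ⊢
    have h2 : besselJ 2 x = 2 * besselJ 1 x / x - besselJ 0 x := by
      field_simp
      linarith
    rw [h2]
    field_simp
    ring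
  have hanti : AntitoneOn (fun x => D x * Real.exp x⁻¹) (Set.Ici 1) := by
    have hd : ∀ x : ℝ, 1 ≤ x → HasDerivAt (fun x => D x * Real.exp x⁻¹)
        (besselJ 0 x * besselJ 1 x / x * Real.exp x⁻¹
          + D x * (Real.exp x⁻¹ * -(x ^ 2)⁻¹)) x := fun x hx =>
      (hderiv x hx).mul ((hasDerivAt_inv (by positivity)).exp)
    refine antitoneOn_of_deriv_nonpos (convex_Ici 1)
      (fun x hx => (hd x hx).continuousAt.continuousWithinAt)
      (fun x hx => (hd x (interior_subset hx)).differentiableAt.differentiableWithinAt) ?_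
    intro x hx
    have hx1 : 1 ≤ x := interior_subset hx
    rw [(hd x hx1).deriv]
    have hx0 : (0 : ℝ) < x := by positivity
    have h := hlow x hx1
    have hle : besselJ 0 x * besselJ 1 x / x ≤ D x * (x ^ 2)⁻¹ := by
      rw [← div_eq_mul_inv, div_le_div_iff₀ hx0 (by positivity)]
      have : besselJ 0 x * besselJ 1 x * x ≤ D x := by
        nlinarith [mul_nonneg hx0.le (sq_nonneg (besselJ 0 x - besselJ 1 x))]
      nlinarith
    nlinarith [Real.exp_pos x⁻¹]
  refine ⟨2 * (D 1 * Real.exp 1), ?_, fun x hx => ?_⟩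
  · have := hlow 1 le_rfl
    have h2 : 0 ≤ D 1 := by nlinarith [sq_nonneg (besselJ 0 1), sq_nonneg (besselJ 1 1)]
    positivity
  · have h := hanti (Set.mem_Ici.2 le_rfl) (Set.mem_Ici.2 hx) hx
    simp only [inv_one] at h
    have h1 := hlow x hx
    have h2 : 0 ≤ D x := by
      have : 0 ≤ x * (besselJ 0 x ^ 2 + besselJ 1 x ^ 2) := by positivity
      linarith
    have h3 : 1 ≤ Real.exp x⁻¹ := Real.one_le_exp (by positivity)
    nlinarith

lemma exists_abs_besselJ_le (n : ℕ) :
    ∃ C : ℝ, ∀ x : ℝ, 1 ≤ x → |besselJ n x| ≤ C * x ^ (-(1 / 2) : ℝ) := by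
  suffices h : ∃ C : ℝ, ∀ x : ℝ, 1 ≤ x → |besselJ n x| ≤ C * x ^ (-(1 / 2) : ℝ) ∧
      |besselJ (n + 1) x| ≤ C * x ^ (-(1 / 2) : ℝ) by
    obtain ⟨C, hC⟩ := h
    exact ⟨C, fun x hx => (hC x hx).1⟩
  induction n with
  | zero =>
    obtain ⟨C, hC0, hC⟩ := exists_besselJ_energy_le
    refine ⟨√C, fun x hx => ?_⟩
    have hx0 : (0 : ℝ) < x := by positivity
    have hsq : √C * x ^ (-(1 / 2) : ℝ) = √(C / x) := by
      rw [Real.sqrt_div hC0, Real.rpow_neg hx0.le, ← Real.sqrt_eq_rpow, div_eq_mul_inv]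
    have hle : besselJ 0 x ^ 2 + besselJ 1 x ^ 2 ≤ C / x := by
      rw [le_div_iff₀ hx0]
      linarith [hC x hx]
    rw [hsq]
    constructor <;> apply Real.abs_le_sqrt <;>
      nlinarith [sq_nonneg (besselJ 0 x), sq_nonneg (besselJ 1 x)]
  | succ n ih =>
    obtain ⟨C, hC⟩ := ih
    refine ⟨(2 * (n + 1) + 1) * C, fun x hx => ?_⟩
    obtain ⟨h0, h1⟩ := hC x hx
    have hx0 : (0 : ℝ) < x := by positivity
    have hb : 0 ≤ C * x ^ (-(1 / 2) : ℝ) := (abs_nonneg _).trans h0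
    have hrec : besselJ (n + 2) x = 2 * (n + 1) * besselJ (n + 1) x / x - besselJ n x := by
      rw [← besselJ_recurrence]
      field_simp
      ring
    constructor
    · nlinarith [(Nat.cast_nonneg n : (0 : ℝ) ≤ n)]
    · rw [hrec]
      have h2 : |2 * ((n : ℝ) + 1) * besselJ (n + 1) x / x|
          ≤ 2 * (n + 1) * (C * x ^ (-(1 / 2) : ℝ)) := by
        rw [abs_div, abs_mul, abs_of_pos hx0, abs_of_nonneg (by positivity)]
        refine (div_le_self (by positivity) hx).trans ?_
        gcongr
      linarith [abs_sub (2 * ((n : ℝ) + 1) * besselJ (n + 1) x / x) (besselJ n x)]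

lemma tendsto_besselJ_atTop (n : ℕ) : Tendsto (besselJ n) atTop (𝓝 0) := by
  obtain ⟨C, hC⟩ := exists_abs_besselJ_le n
  have h : Tendsto (fun x : ℝ => C * x ^ (-(1 / 2) : ℝ)) atTop (𝓝 (C * 0)) :=
    (tendsto_rpow_neg_atTop (by norm_num)).const_mul C
  rw [mul_zero] at h
  refine squeeze_zero_norm' ?_ h
  filter_upwards [eventually_ge_atTop 1] with x hx using hC x hx

/-- The truncated sine transform of `J_n`. -/
noncomputable def besselSin (n : ℕ) (R t : ℝ) : ℝ :=
  ∫ x in (0 : ℝ)..R, besselJ n x * Real.sin (x * t)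

/-- The truncated cosine transform of `J_n`. -/
noncomputable def besselCos (n : ℕ) (R t : ℝ) : ℝ :=
  ∫ x in (0 : ℝ)..R, besselJ n x * Real.cos (x * t)

lemma hasDerivAt_sin_mul_const (t x : ℝ) :
    HasDerivAt (fun x : ℝ => Real.sin (x * t)) (t * Real.cos (x * t)) x :=
  (((hasDerivAt_id x).mul_const t).sin).congr_deriv (by simp; ring)

lemma hasDerivAt_cos_mul_const (t x : ℝ) :
    HasDerivAt (fun x : ℝ => Real.cos (x * t)) (-(t * Real.sin (x * t))) x :=
  (((hasDerivAt_id x).mul_const t).cos).congr_deriv (by simp; ring)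

lemma besselSin_recurrence (n : ℕ) (R t : ℝ) :
    besselSin (n + 2) R t = besselSin n R t
      + 2 * (t * besselCos (n + 1) R t) - 2 * (besselJ (n + 1) R * Real.sin (R * t)) := by
  have h0 := continuous_besselJ n
  have h1 := continuous_besselJ (n + 1)
  have h2 := continuous_besselJ (n + 2)
  have key := intervalIntegral.integral_eq_sub_of_hasDerivAt (a := 0) (b := R)
    (fun x _ => (hasDerivAt_besselJ_succ n x).mul (hasDerivAt_sin_mul_const t x))
    (Continuous.intervalIntegrable (by fun_prop) _ _)
  have e : besselSin n R t - besselSin (n + 2) R t + 2 * (t * besselCos (n + 1) R t)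
      = 2 * ∫ x in (0 : ℝ)..R, ((besselJ n x - besselJ (n + 2) x) / 2 * Real.sin (x * t)
        + besselJ (n + 1) x * (t * Real.cos (x * t))) := by
    simp only [besselSin, besselCos, ← intervalIntegral.integral_const_mul]
    rw [← intervalIntegral.integral_sub, ← intervalIntegral.integral_add]
    · exact intervalIntegral.integral_congr fun x _ => by ring
    all_goals exact Continuous.intervalIntegrable (by fun_prop) _ _
  rw [key] at e
  simp at e
  linarith

lemma besselCos_recurrence (n : ℕ) (R t : ℝ) :
    besselCos (n + 2) R t = besselCos n R t
      - 2 * (t * besselSin (n + 1) R t) - 2 * (besselJ (n + 1) R * Real.cos (R * t)) := by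
  have h0 := continuous_besselJ n
  have h1 := continuous_besselJ (n + 1)
  have h2 := continuous_besselJ (n + 2)
  have key := intervalIntegral.integral_eq_sub_of_hasDerivAt (a := 0) (b := R)
    (fun x _ => (hasDerivAt_besselJ_succ n x).mul (hasDerivAt_cos_mul_const t x))
    (Continuous.intervalIntegrable (by fun_prop) _ _)
  have e : besselCos n R t - besselCos (n + 2) R t - 2 * (t * besselSin (n + 1) R t)
      = 2 * ∫ x in (0 : ℝ)..R, ((besselJ n x - besselJ (n + 2) x) / 2 * Real.cos (x * t)
        + besselJ (n + 1) x * (-(t * Real.sin (x * t)))) := by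
    simp only [besselSin, besselCos, ← intervalIntegral.integral_const_mul]
    rw [← intervalIntegral.integral_sub, ← intervalIntegral.integral_sub]
    · exact intervalIntegral.integral_congr fun x _ => by ring
    all_goals exact Continuous.intervalIntegrable (by fun_prop) _ _
  rw [key] at e
  have hz : besselJ (n + 1) 0 = 0 := by simp [besselJ_eq_besselE]
  simp [hz] at e
  linarith

lemma besselCos_one (R t : ℝ) :
    besselCos 1 R t = 1 - t * besselSin 0 R t - besselJ 0 R * Real.cos (R * t) := by
  have h0 := continuous_besselJ 0
  have h1 := continuous_besselJ 1
  have key := intervalIntegral.integral_eq_sub_of_hasDerivAt (a := 0) (b := R)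
    (fun x _ => (hasDerivAt_besselJ_zero x).mul (hasDerivAt_cos_mul_const t x))
    (Continuous.intervalIntegrable (by fun_prop) _ _)
  have e : besselCos 1 R t + t * besselSin 0 R t
      = - ∫ x in (0 : ℝ)..R, (-besselJ 1 x * Real.cos (x * t)
        + besselJ 0 x * (-(t * Real.sin (x * t)))) := by
    simp only [besselSin, besselCos, ← intervalIntegral.integral_const_mul,
      ← intervalIntegral.integral_neg]
    rw [← intervalIntegral.integral_add]
    · exact intervalIntegral.integral_congr fun x _ => by ring
    all_goals exact Continuous.intervalIntegrable (by fun_prop) _ _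
  rw [key] at e
  simp [besselJ_zero_zero] at e
  linarith

lemma hasDerivAt_besselSin (n : ℕ) (R t : ℝ) :
    HasDerivAt (besselSin n R) (∫ x in (0 : ℝ)..R, besselJ n x * (x * Real.cos (x * t))) t := by
  have h0 := continuous_besselJ n
  refine (intervalIntegral.hasDerivAt_integral_of_dominated_loc_of_deriv_le
    (F := fun t x => besselJ n x * Real.sin (x * t))
    (F' := fun t x => besselJ n x * (x * Real.cos (x * t)))
    (bound := fun x => |besselJ n x| * |x|) (s := Set.univ) Filter.univ_mem
    (Filter.Eventually.of_forall fun t => Continuous.aestronglyMeasurable (by fun_prop))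
    (Continuous.intervalIntegrable (by fun_prop) _ _)
    (Continuous.aestronglyMeasurable (by fun_prop)) ?_
    (Continuous.intervalIntegrable (by fun_prop) _ _) ?_).2
  · refine Filter.Eventually.of_forall fun x _ t _ => ?_
    rw [Real.norm_eq_abs, abs_mul, abs_mul]
    gcongr
    exact mul_le_of_le_one_right (abs_nonneg _) (Real.abs_cos_le_one _)
  · refine Filter.Eventually.of_forall fun x _ t _ => ?_
    refine HasDerivAt.const_mul _ ?_
    exact (((hasDerivAt_id t).const_mul x).sin).congr_deriv (by simp; ring)

lemma besselSin_zero_ode (R t : ℝ) :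
    (1 - t ^ 2) * (∫ x in (0 : ℝ)..R, besselJ 0 x * (x * Real.cos (x * t)))
      - t * besselSin 0 R t
      = R * (besselJ 1 R * Real.cos (R * t) - t * besselJ 0 R * Real.sin (R * t)) := by
  have h0 := continuous_besselJ 0
  have h1 := continuous_besselJ 1
  have hd : ∀ x : ℝ, HasDerivAt
      (fun x => x * (besselJ 1 x * Real.cos (x * t)) - t * (x * (besselJ 0 x * Real.sin (x * t))))
      ((1 - t ^ 2) * (besselJ 0 x * (x * Real.cos (x * t)))
        - t * (besselJ 0 x * Real.sin (x * t))) x := by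
    intro x
    have hrec := besselJ_recurrence 0 x
    refine (((hasDerivAt_id x).mul ((hasDerivAt_besselJ_succ 0 x).mul
      (hasDerivAt_cos_mul_const t x))).sub (((hasDerivAt_id x).mul
        ((hasDerivAt_besselJ_zero x).mul (hasDerivAt_sin_mul_const t x))).const_mul t)).congr_deriv ?_
    norm_num at hrec ⊢
    linear_combination (-(Real.cos (x * t)) / 2) * hrec
  have key := intervalIntegral.integral_eq_sub_of_hasDerivAt (a := 0) (b := R)
    (fun x _ => hd x) (Continuous.intervalIntegrable (by fun_prop) _ _)
  rw [intervalIntegral.integral_sub (Continuous.intervalIntegrable (by fun_prop) _ _)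
    (Continuous.intervalIntegrable (by fun_prop) _ _), intervalIntegral.integral_const_mul,
    intervalIntegral.integral_const_mul] at key
  rw [besselSin, key]
  simp
  ring

lemma hasDerivAt_sqrt_one_sub_sq {s : ℝ} (hs : s ^ 2 < 1) :
    HasDerivAt (fun s : ℝ => √(1 - s ^ 2)) (-(s / √(1 - s ^ 2))) s := by
  refine (((hasDerivAt_pow 2 s).const_sub 1).sqrt (by linarith)).congr_deriv ?_
  have : √(1 - s ^ 2) ≠ 0 := (Real.sqrt_pos.2 (by linarith)).ne'
  field_simp
  norm_num

lemma exists_abs_besselSin_zero_le {τ : ℝ} (h0 : 0 ≤ τ) (h1 : τ < 1) :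
    ∃ C : ℝ, ∀ R t : ℝ, t ∈ Set.Icc (-τ) τ →
      |besselSin 0 R t| ≤ C * (|besselJ 0 R| + |besselJ 1 R|) := by
  set w : ℝ → ℝ := fun s => √(1 - s ^ 2) with hw
  have hwτ : 0 < w τ := Real.sqrt_pos.2 (by nlinarith)
  have hsq : ∀ s ∈ Set.Icc (-τ) τ, s ^ 2 ≤ τ ^ 2 := fun s hs => by
    rw [sq_le_sq, abs_of_nonneg h0]
    exact abs_le.2 hs
  have hwle : ∀ s ∈ Set.Icc (-τ) τ, w τ ≤ w s := fun s hs =>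
    Real.sqrt_le_sqrt (by linarith [hsq s hs])
  refine ⟨(1 / w τ ^ 3 + 1 / w τ) / w τ, fun R t ht => ?_⟩
  set a := besselJ 1 R with ha
  set b := besselJ 0 R with hb
  set h : ℝ → ℝ := fun s => w s * besselSin 0 R s
    - (a * Real.sin (R * s) + b * (s * Real.cos (R * s))) / w s with hh
  have hderiv : ∀ s ∈ Set.Icc (-τ) τ, HasDerivAt h
      (-(a * (s * Real.sin (R * s)) + b * Real.cos (R * s)) / w s ^ 3) s := by
    intro s hs
    have hs1 : s ^ 2 < 1 := by nlinarith [hsq s hs]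
    have hws : 0 < w s := hwτ.trans_le (hwle s hs)
    have hws2 : w s ^ 2 = 1 - s ^ 2 := Real.sq_sqrt (by linarith)
    have hdw : HasDerivAt w (-(s / w s)) s := hasDerivAt_sqrt_one_sub_sq hs1
    have hsin : HasDerivAt (fun s => Real.sin (R * s)) (R * Real.cos (R * s)) s :=
      (((hasDerivAt_id s).const_mul R).sin).congr_deriv (by simp; ring)
    have hcos : HasDerivAt (fun s => Real.cos (R * s)) (-(R * Real.sin (R * s))) s :=
      (((hasDerivAt_id s).const_mul R).cos).congr_deriv (by simp; ring)
    refine ((hdw.mul (hasDerivAt_besselSin 0 R s)).sub (((hsin.const_mul a).add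
      (((hasDerivAt_id s).mul hcos).const_mul b)).div hdw hws.ne')).congr_deriv ?_
    have hode := besselSin_zero_ode R s
    rw [← ha, ← hb, ← hws2] at hode
    simp only [id_eq, Pi.mul_apply, Pi.add_apply] at hode ⊢
    generalize (∫ x in (0 : ℝ)..R, besselJ 0 x * (x * Real.cos (x * s))) = g' at *
    generalize besselSin 0 R s = g at *
    generalize w s = v at *
    generalize Real.sin (R * s) = S at *
    generalize Real.cos (R * s) = K at *
    have hs2 : s ^ 2 = 1 - v ^ 2 := by linarith
    field_simp
    linear_combination v ^ 2 * hode - b * K * hs2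
  have hbound : ∀ s ∈ Set.Icc (-τ) τ,
      ‖-(a * (s * Real.sin (R * s)) + b * Real.cos (R * s)) / w s ^ 3‖
        ≤ (|b| + |a|) / w τ ^ 3 := by
    intro s hs
    have hws : 0 < w s := hwτ.trans_le (hwle s hs)
    have hs1 : |s| ≤ 1 := (abs_le.2 hs).trans h1.le
    rw [norm_div, norm_neg, Real.norm_eq_abs, norm_pow, Real.norm_eq_abs, abs_of_pos hws]
    have hn : |a * (s * Real.sin (R * s)) + b * Real.cos (R * s)| ≤ |b| + |a| := by
      refine (abs_add_le _ _).trans ?_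
      rw [abs_mul, abs_mul, abs_mul, add_comm]
      gcongr
      · exact mul_le_of_le_one_right (abs_nonneg _) (Real.abs_cos_le_one _)
      · exact mul_le_of_le_one_right (abs_nonneg _)
          (mul_le_one₀ hs1 (abs_nonneg _) (Real.abs_sin_le_one _))
    have := hwle s hs
    gcongr
  have hmv := (convex_Icc (-τ) τ).norm_image_sub_le_of_norm_hasDerivWithin_le
    (fun s hs => (hderiv s hs).hasDerivWithinAt) hbound
    (show (0 : ℝ) ∈ Set.Icc (-τ) τ from ⟨by linarith, h0⟩) ht
  have hh0 : h 0 = 0 := by simp [hh, besselSin]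
  have ht1 : |t| ≤ 1 := (abs_le.2 ht).trans h1.le
  have hht : |h t| ≤ (|b| + |a|) / w τ ^ 3 := by
    rw [hh0, sub_zero, sub_zero, Real.norm_eq_abs, Real.norm_eq_abs] at hmv
    exact hmv.trans (mul_le_of_le_one_right (by positivity) ht1)
  have hwt := hwle t ht
  have hwt0 : 0 < w t := hwτ.trans_le hwt
  have hq : |(a * Real.sin (R * t) + b * (t * Real.cos (R * t))) / w t| ≤ (|b| + |a|) / w τ := by
    rw [abs_div, abs_of_pos hwt0]
    have hn : |a * Real.sin (R * t) + b * (t * Real.cos (R * t))| ≤ |b| + |a| := by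
      refine (abs_add_le _ _).trans ?_
      rw [abs_mul, abs_mul, abs_mul, add_comm]
      gcongr
      · exact mul_le_of_le_one_right (abs_nonneg _)
          (mul_le_one₀ ht1 (abs_nonneg _) (Real.abs_cos_le_one _))
      · exact mul_le_of_le_one_right (abs_nonneg _) (Real.abs_sin_le_one _)
    gcongr
  have hprod : w t * |besselSin 0 R t| ≤ (|b| + |a|) / w τ ^ 3 + (|b| + |a|) / w τ := by
    rw [← abs_of_pos hwt0, ← abs_mul]
    have e : w t * besselSin 0 R t
        = h t + (a * Real.sin (R * t) + b * (t * Real.cos (R * t))) / w t := by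
      simp only [hh]; ring
    rw [e]
    exact (abs_add_le _ _).trans (add_le_add hht hq)
  have h3 : w τ * |besselSin 0 R t| ≤ (|b| + |a|) / w τ ^ 3 + (|b| + |a|) / w τ :=
    (mul_le_mul_of_nonneg_right hwt (abs_nonneg _)).trans hprod
  calc |besselSin 0 R t| ≤ ((|b| + |a|) / w τ ^ 3 + (|b| + |a|) / w τ) / w τ := by
        rw [le_div_iff₀ hwτ]; linarith
    _ = _ := by ring

/-- The polynomials `A_k`, `B_k` with `∫₀^∞ J_{2k+1}(x) cos(xt) dx = A_k(t)` and
`∫₀^∞ J_{2k+2}(x) sin(xt) dx = B_k(t)` for `|t| < 1`. -/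
noncomputable def besselPoly : ℕ → Polynomial ℝ × Polynomial ℝ
  | 0 => (1, 2 * Polynomial.X)
  | k + 1 =>
    ((besselPoly k).1 - 2 * Polynomial.X * (besselPoly k).2,
      (besselPoly k).2
        + 2 * Polynomial.X * ((besselPoly k).1 - 2 * Polynomial.X * (besselPoly k).2))

lemma natDegree_two_mul_X_mul_le (p : Polynomial ℝ) {d : ℕ} (hp : p.natDegree ≤ d) :
    (2 * Polynomial.X * p).natDegree ≤ d + 1 := by
  rw [mul_assoc]
  refine (Polynomial.natDegree_C_mul_le 2 _).trans ?_
  refine Polynomial.natDegree_mul_le.trans ?_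
  rw [Polynomial.natDegree_X]
  omega

lemma coeff_two_mul_X_mul (p : Polynomial ℝ) (d : ℕ) :
    (2 * Polynomial.X * p).coeff (d + 1) = 2 * p.coeff d := by
  rw [mul_assoc]
  refine (Polynomial.coeff_C_mul (a := (2 : ℝ)) _).trans ?_
  rw [Polynomial.coeff_X_mul]

lemma natDegree_besselPoly_le (k : ℕ) :
    (besselPoly k).1.natDegree ≤ 2 * k ∧ (besselPoly k).2.natDegree ≤ 2 * k + 1 := by
  induction k with
  | zero =>
    refine ⟨by simp [besselPoly], ?_⟩
    simp [besselPoly]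
  | succ k ih =>
    have h1 : ((besselPoly k).1 - 2 * Polynomial.X * (besselPoly k).2).natDegree ≤ 2 * k + 2 :=
      (Polynomial.natDegree_sub_le _ _).trans
        (max_le (by omega) (natDegree_two_mul_X_mul_le _ ih.2))
    refine ⟨h1, ?_⟩
    exact (Polynomial.natDegree_add_le _ _).trans
      (max_le (by omega) (natDegree_two_mul_X_mul_le _ h1))

lemma coeff_besselPoly (k : ℕ) :
    (besselPoly k).1.coeff (2 * k) = (-1) ^ k * 2 ^ (2 * k) ∧
      (besselPoly k).2.coeff (2 * k + 1) = (-1) ^ k * 2 ^ (2 * k + 1) := by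
  induction k with
  | zero =>
    refine ⟨by simp [besselPoly], ?_⟩
    simp [besselPoly]
  | succ k ih =>
    have hd := natDegree_besselPoly_le k
    have h1 : ((besselPoly k).1 - 2 * Polynomial.X * (besselPoly k).2).coeff (2 * k + 2)
        = (-1) ^ (k + 1) * 2 ^ (2 * k + 2) := by
      rw [Polynomial.coeff_sub, coeff_two_mul_X_mul, ih.2,
        Polynomial.coeff_eq_zero_of_natDegree_lt (by omega)]
      ring
    refine ⟨h1, ?_⟩
    change ((besselPoly k).2 + 2 * Polynomial.X *
      ((besselPoly k).1 - 2 * Polynomial.X * (besselPoly k).2)).coeff (2 * k + 2 + 1) = _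
    rw [Polynomial.coeff_add, coeff_two_mul_X_mul, h1,
      Polynomial.coeff_eq_zero_of_natDegree_lt (by omega)]
    ring

lemma tendsto_besselJ_mul_prod (n : ℕ) (s : Set ℝ) {c : ℝ × ℝ → ℝ} (hc : ∀ q, |c q| ≤ 1) :
    Tendsto (fun q : ℝ × ℝ => besselJ n q.1 * c q) (atTop ×ˢ 𝓟 s) (𝓝 0) := by
  refine squeeze_zero_norm (fun q => ?_) ((tendsto_besselJ_atTop n).norm.comp tendsto_fst |>.trans
    (by rw [norm_zero]))
  rw [norm_mul]
  exact mul_le_of_le_one_right (norm_nonneg _) (hc q)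

lemma tendsto_snd_mul_prod {τ : ℝ} (h1 : τ < 1) {u : ℝ × ℝ → ℝ}
    (hu : Tendsto u (atTop ×ˢ 𝓟 (Set.Icc (-τ) τ)) (𝓝 0)) :
    Tendsto (fun q : ℝ × ℝ => q.2 * u q) (atTop ×ˢ 𝓟 (Set.Icc (-τ) τ)) (𝓝 0) := by
  refine squeeze_zero_norm' ?_ (hu.norm.trans (by rw [norm_zero]))
  have : ∀ᶠ q : ℝ × ℝ in atTop ×ˢ 𝓟 (Set.Icc (-τ) τ), q.2 ∈ Set.Icc (-τ) τ :=
    tendsto_snd.eventually (mem_principal_self (Set.Icc (-τ) τ))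
  filter_upwards [this] with q hq
  rw [norm_mul]
  exact mul_le_of_le_one_left (norm_nonneg _) ((abs_le.2 hq).trans h1.le)

lemma tendsto_besselSin_zero {τ : ℝ} (h0 : 0 ≤ τ) (h1 : τ < 1) :
    Tendsto (fun q : ℝ × ℝ => besselSin 0 q.1 q.2) (atTop ×ˢ 𝓟 (Set.Icc (-τ) τ)) (𝓝 0) := by
  obtain ⟨C, hC⟩ := exists_abs_besselSin_zero_le h0 h1
  have hlim : Tendsto (fun q : ℝ × ℝ => C * (|besselJ 0 q.1| + |besselJ 1 q.1|))
      (atTop ×ˢ 𝓟 (Set.Icc (-τ) τ)) (𝓝 0) := by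
    have := (((tendsto_besselJ_atTop 0).abs.add (tendsto_besselJ_atTop 1).abs).const_mul C).comp
      (tendsto_fst (f := atTop) (g := 𝓟 (Set.Icc (-τ) τ)))
    simpa [Function.comp_def] using this
  refine squeeze_zero_norm' ?_ hlim
  have : ∀ᶠ q : ℝ × ℝ in atTop ×ˢ 𝓟 (Set.Icc (-τ) τ), q.2 ∈ Set.Icc (-τ) τ :=
    tendsto_snd.eventually (mem_principal_self (Set.Icc (-τ) τ))
  filter_upwards [this] with q hq using hC q.1 q.2 hq

/-- The Fourier transforms of `J_{2k+1}` and `J_{2k+2}` converge, uniformly on compact subsets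
of `(-1, 1)`, to polynomials. -/
lemma tendsto_besselCos_besselSin {τ : ℝ} (h0 : 0 ≤ τ) (h1 : τ < 1) (k : ℕ) :
    Tendsto (fun q : ℝ × ℝ => besselCos (2 * k + 1) q.1 q.2 - (besselPoly k).1.eval q.2)
        (atTop ×ˢ 𝓟 (Set.Icc (-τ) τ)) (𝓝 0) ∧
      Tendsto (fun q : ℝ × ℝ => besselSin (2 * k + 2) q.1 q.2 - (besselPoly k).2.eval q.2)
        (atTop ×ˢ 𝓟 (Set.Icc (-τ) τ)) (𝓝 0) := by
  have hcos (n : ℕ) := tendsto_besselJ_mul_prod n (Set.Icc (-τ) τ)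
    (c := fun q => Real.cos (q.1 * q.2)) fun q => Real.abs_cos_le_one _
  have hsin (n : ℕ) := tendsto_besselJ_mul_prod n (Set.Icc (-τ) τ)
    (c := fun q => Real.sin (q.1 * q.2)) fun q => Real.abs_sin_le_one _
  induction k with
  | zero =>
    have hS := tendsto_besselSin_zero h0 h1
    have hC : Tendsto (fun q : ℝ × ℝ => besselCos 1 q.1 q.2 - 1)
        (atTop ×ˢ 𝓟 (Set.Icc (-τ) τ)) (𝓝 0) := by
      have h := ((tendsto_snd_mul_prod h1 hS).add (hcos 0)).neg
      rw [add_zero, neg_zero] at h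
      refine h.congr fun q => ?_
      rw [besselCos_one]
      ring
    refine ⟨by simpa [besselPoly] using hC, ?_⟩
    have h := (hS.add ((tendsto_snd_mul_prod h1 hC).const_mul 2)).sub ((hsin 1).const_mul 2)
    simp only [mul_zero, add_zero, sub_zero] at h
    refine h.congr fun q => ?_
    rw [besselSin_recurrence]
    simp [besselPoly]
    ring
  | succ k ih =>
    have hC : Tendsto (fun q : ℝ × ℝ => besselCos (2 * k + 3) q.1 q.2
        - (besselPoly (k + 1)).1.eval q.2) (atTop ×ˢ 𝓟 (Set.Icc (-τ) τ)) (𝓝 0) := by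
      have h := (ih.1.sub ((tendsto_snd_mul_prod h1 ih.2).const_mul 2)).sub
        ((hcos (2 * k + 2)).const_mul 2)
      simp only [mul_zero, sub_zero] at h
      refine h.congr fun q => ?_
      rw [besselCos_recurrence (2 * k + 1)]
      simp [besselPoly]
      ring
    refine ⟨hC, ?_⟩
    have h := (ih.2.add ((tendsto_snd_mul_prod h1 hC).const_mul 2)).sub
      ((hsin (2 * k + 3)).const_mul 2)
    simp only [mul_zero, add_zero, sub_zero] at h
    refine h.congr fun q => ?_
    rw [show 2 * (k + 1) + 2 = 2 * k + 2 + 2 by ring, besselSin_recurrence (2 * k + 2)]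
    simp [besselPoly]
    ring

lemma integral_iteratedDeriv_mul {a b : ℝ} {φ f : ℝ → ℝ} (hφ : ContDiff ℝ ∞ φ)
    (hf : ContDiff ℝ ∞ f) (r : ℕ)
    (hv : ∀ j < r, iteratedDeriv j φ a = 0 ∧ iteratedDeriv j φ b = 0) :
    ∫ t in a..b, iteratedDeriv r φ t * f t
      = (-1) ^ r * ∫ t in a..b, φ t * iteratedDeriv r f t := by
  induction r generalizing f with
  | zero => simp
  | succ r ih =>
    have hd : ∀ t, HasDerivAt (iteratedDeriv r φ) (iteratedDeriv (r + 1) φ t) t := fun t => by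
      rw [iteratedDeriv_succ]
      exact ((hφ.differentiable_iteratedDeriv r (by exact_mod_cast WithTop.coe_lt_top _))
        t).hasDerivAt
    have hf' : ContDiff ℝ ∞ (deriv f) := ((contDiff_infty_iff_deriv).1 hf).2
    have hdf : ∀ t, HasDerivAt f (deriv f t) t := fun t =>
      ((contDiff_infty_iff_deriv.1 hf).1 t).hasDerivAt
    have hc : Continuous (iteratedDeriv (r + 1) φ) :=
      hφ.continuous_iteratedDeriv (r + 1) (by exact_mod_cast le_top)
    have key := intervalIntegral.integral_mul_deriv_eq_deriv_mul (a := a) (b := b)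
      (fun t _ => hd t) (fun t _ => hdf t) (hc.intervalIntegrable _ _)
      (hf'.continuous.intervalIntegrable _ _)
    rw [(hv r (by omega)).1, (hv r (by omega)).2, ih hf' fun j hj => hv j (by omega)] at key
    have hs : iteratedDeriv (r + 1) f = iteratedDeriv r (deriv f) := iteratedDeriv_succ'
    rw [hs, pow_succ]
    linarith

lemma hasDerivAt_cos_half (t : ℝ) :
    HasDerivAt (fun t : ℝ => Real.cos (t / 2)) (-(Real.sin (t / 2) / 2)) t :=
  (((hasDerivAt_id t).div_const 2).cos).congr_deriv (by simp; ring)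

lemma iteratedDeriv_cos_half_pow (q : ℕ) {j : ℕ} (hj : j ≤ q) :
    ∃ g : ℝ → ℝ, ContDiff ℝ ∞ g ∧
      iteratedDeriv j (fun t : ℝ => Real.cos (t / 2) ^ q)
        = fun t => Real.cos (t / 2) ^ (q - j) * g t := by
  induction j with
  | zero => exact ⟨fun _ => 1, contDiff_const, by simp⟩
  | succ j ih =>
    obtain ⟨g, hg, he⟩ := ih (by omega)
    obtain ⟨i, hi⟩ : ∃ i, q - j = i + 1 := ⟨q - j - 1, by omega⟩
    have hg' : ContDiff ℝ ∞ (deriv g) := ((contDiff_infty_iff_deriv).1 hg).2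
    refine ⟨fun t => -((i + 1) * Real.sin (t / 2) / 2 * g t) + Real.cos (t / 2) * deriv g t,
      ?_, ?_⟩
    · have h2 : ContDiff ℝ ∞ fun t : ℝ => t / 2 := contDiff_id.div_const 2
      have hs := Real.contDiff_sin.comp h2
      have hc := Real.contDiff_cos.comp h2
      exact ((((contDiff_const (c := (i : ℝ) + 1)).mul hs).div_const 2).mul hg).neg.add (hc.mul hg')
    · rw [iteratedDeriv_succ, he, hi, show q - (j + 1) = i by omega]
      funext t
      have hgt := ((contDiff_infty_iff_deriv.1 hg).1 t).hasDerivAt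
      refine (((hasDerivAt_cos_half t).pow (i + 1)).mul hgt).deriv.trans ?_
      simp
      ring

lemma iteratedDeriv_cos_half_pow_pi (q : ℕ) {j : ℕ} (hj : j < q) :
    iteratedDeriv j (fun t : ℝ => Real.cos (t / 2) ^ q) (-π) = 0 ∧
      iteratedDeriv j (fun t : ℝ => Real.cos (t / 2) ^ q) π = 0 := by
  obtain ⟨g, -, he⟩ := iteratedDeriv_cos_half_pow q hj.le
  have h : q - j ≠ 0 := by omega
  simp [he, h, neg_div]

/-- The Fourier transform of `cos(t / 2) ^ q` on `[-π, π]`. -/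
noncomputable def cosPowTransform (q : ℕ) (x : ℝ) : ℝ :=
  ∫ t in (-π)..π, Real.cos (t / 2) ^ q * Real.cos (x * t)

lemma continuous_cosPowTransform (q : ℕ) : Continuous (cosPowTransform q) :=
  intervalIntegral.continuous_parametric_intervalIntegral_of_continuous'
    (f := fun x t : ℝ => Real.cos (t / 2) ^ q * Real.cos (x * t))
    (by unfold Function.uncurry; fun_prop) _ _

lemma hasDerivAt_cos_const_mul (x t : ℝ) :
    HasDerivAt (fun t : ℝ => Real.cos (x * t)) (-(x * Real.sin (x * t))) t :=
  (((hasDerivAt_id t).const_mul x).cos).congr_deriv (by simp; ring)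

lemma hasDerivAt_sin_const_mul (x t : ℝ) :
    HasDerivAt (fun t : ℝ => Real.sin (x * t)) (x * Real.cos (x * t)) t :=
  (((hasDerivAt_id t).const_mul x).sin).congr_deriv (by simp; ring)

lemma hasDerivAt_sin_half (t : ℝ) :
    HasDerivAt (fun t : ℝ => Real.sin (t / 2)) (Real.cos (t / 2) / 2) t :=
  (((hasDerivAt_id t).div_const 2).sin).congr_deriv (by simp; ring)

lemma cosPowTransform_one (x : ℝ) :
    ((1 / 2) ^ 2 - x ^ 2) * cosPowTransform 1 x = Real.cos (π * x) := by
  have hd : ∀ t : ℝ, HasDerivAt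
      (fun t => Real.sin (t / 2) / 2 * Real.cos (x * t) - x * (Real.cos (t / 2) * Real.sin (x * t)))
      (((1 / 2) ^ 2 - x ^ 2) * (Real.cos (t / 2) ^ 1 * Real.cos (x * t))) t := by
    intro t
    refine ((((hasDerivAt_sin_half t).div_const 2).mul (hasDerivAt_cos_const_mul x t)).sub
      (((hasDerivAt_cos_half t).mul (hasDerivAt_sin_const_mul x t)).const_mul x)).congr_deriv ?_
    ring
  have key := intervalIntegral.integral_eq_sub_of_hasDerivAt (a := -π) (b := π)
    (fun t _ => hd t) (Continuous.intervalIntegrable (by fun_prop) _ _)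
  rw [intervalIntegral.integral_const_mul] at key
  rw [cosPowTransform, key]
  simp [neg_div]
  ring_nf

lemma cosPowTransform_add_two (q : ℕ) (x : ℝ) :
    ((((q : ℝ) + 2) / 2) ^ 2 - x ^ 2) * cosPowTransform (q + 2) x
      = (q + 2) * (q + 1) / 4 * cosPowTransform q x := by
  have hd : ∀ t : ℝ, HasDerivAt
      (fun t => (q + 2) / 2 * (Real.cos (t / 2) ^ (q + 1) * Real.sin (t / 2)) * Real.cos (x * t)
        - x * (Real.cos (t / 2) ^ (q + 2) * Real.sin (x * t)))
      (((((q : ℝ) + 2) / 2) ^ 2 - x ^ 2) * (Real.cos (t / 2) ^ (q + 2) * Real.cos (x * t))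
        - (q + 2) * (q + 1) / 4 * (Real.cos (t / 2) ^ q * Real.cos (x * t))) t := by
    intro t
    refine ((((((hasDerivAt_cos_half t).pow (q + 1)).mul (hasDerivAt_sin_half t)).const_mul
      (((q : ℝ) + 2) / 2)).mul (hasDerivAt_cos_const_mul x t)).sub
      ((((hasDerivAt_cos_half t).pow (q + 2)).mul
        (hasDerivAt_sin_const_mul x t)).const_mul x)).congr_deriv ?_
    have hs := Real.sin_sq_add_cos_sq (t / 2)
    simp only [Pi.mul_apply, Pi.pow_apply, Nat.add_sub_cancel, Nat.reduceSubDiff]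
    push_cast
    linear_combination (-((q : ℝ) + 2) * (q + 1) / 4 * Real.cos (t / 2) ^ q
      * Real.cos (x * t)) * hs
  have key := intervalIntegral.integral_eq_sub_of_hasDerivAt (a := -π) (b := π)
    (fun t _ => hd t) (Continuous.intervalIntegrable (by fun_prop) _ _)
  rw [intervalIntegral.integral_sub (Continuous.intervalIntegrable (by fun_prop) _ _)
    (Continuous.intervalIntegrable (by fun_prop) _ _), intervalIntegral.integral_const_mul,
    intervalIntegral.integral_const_mul] at key
  rw [← sub_eq_zero, cosPowTransform, cosPowTransform, key]
  simp [neg_div]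

lemma exists_cosPowTransform_decay (N : ℕ) :
    ∃ C : ℝ, ∀ᶠ x : ℝ in atTop, |cosPowTransform (2 * N + 1) x| * x ^ (2 * N + 2) ≤ C := by
  have step : ∀ a x y : ℝ, 0 ≤ a → 2 * a ≤ x → |y| * x ^ 2 ≤ 2 * |(a ^ 2 - x ^ 2) * y| := by
    intro a x y ha hx
    rw [abs_mul, abs_of_nonpos (by nlinarith : a ^ 2 - x ^ 2 ≤ 0)]
    nlinarith [abs_nonneg y, mul_nonneg (abs_nonneg y) (by nlinarith : 0 ≤ x ^ 2 - 2 * a ^ 2)]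
  induction N with
  | zero =>
    refine ⟨2, ?_⟩
    filter_upwards [eventually_ge_atTop (1 : ℝ)] with x hx
    have h := step (1 / 2) x (cosPowTransform 1 x) (by norm_num) (by linarith)
    rw [cosPowTransform_one] at h
    simpa using h.trans (by linarith [Real.abs_cos_le_one (π * x)])
  | succ N ih =>
    obtain ⟨C, hC⟩ := ih
    set a : ℝ := (((2 * N + 1 : ℕ) : ℝ) + 2) / 2 with ha
    set K : ℝ := (((2 * N + 1 : ℕ) : ℝ) + 2) * (((2 * N + 1 : ℕ) : ℝ) + 1) / 4 with hK
    have ha0 : 0 ≤ a := by positivity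
    have hK0 : 0 ≤ K := by positivity
    refine ⟨2 * K * C, ?_⟩
    filter_upwards [hC, eventually_ge_atTop (2 * a)] with x hx hxa
    have hx0 : 0 ≤ x := by linarith
    have h := step a x (cosPowTransform (2 * N + 1 + 2) x) ha0 hxa
    rw [cosPowTransform_add_two, abs_mul, abs_of_nonneg hK0] at h
    calc |cosPowTransform (2 * (N + 1) + 1) x| * x ^ (2 * (N + 1) + 2)
        = |cosPowTransform (2 * N + 1 + 2) x| * x ^ 2 * x ^ (2 * N + 2) := by
          rw [show 2 * (N + 1) + 1 = 2 * N + 1 + 2 by ring]; ring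
      _ ≤ 2 * (K * |cosPowTransform (2 * N + 1) x|) * x ^ (2 * N + 2) := by gcongr
      _ = 2 * K * (|cosPowTransform (2 * N + 1) x| * x ^ (2 * N + 2)) := by ring
      _ ≤ 2 * K * C := by gcongr

lemma exists_inv_Gamma_mul_Gamma_eq (N : ℕ) :
    ∃ c : ℝ, ∀ x : ℝ, (∀ k : ℕ, x ^ 2 ≠ ((k : ℝ) + 1 / 2) ^ 2) →
      (Real.Gamma ((N : ℝ) + 1 + 1 / 2 + x) * Real.Gamma ((N : ℝ) + 1 + 1 / 2 - x))⁻¹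
        = c * cosPowTransform (2 * N + 1) x := by
  have step : ∀ a x : ℝ, a ^ 2 - x ^ 2 ≠ 0 →
      (Real.Gamma (a + 1 + x) * Real.Gamma (a + 1 - x))⁻¹
        = (Real.Gamma (a + x) * Real.Gamma (a - x))⁻¹ / (a ^ 2 - x ^ 2) := by
    intro a x h
    have hf : a ^ 2 - x ^ 2 = (a + x) * (a - x) := by ring
    rw [hf] at h ⊢
    rw [show a + 1 + x = (a + x) + 1 by ring, show a + 1 - x = (a - x) + 1 by ring,
      Real.Gamma_add_one (left_ne_zero_of_mul h), Real.Gamma_add_one (right_ne_zero_of_mul h)]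
    simp only [mul_inv, div_eq_mul_inv]
    ring
  induction N with
  | zero =>
    refine ⟨π⁻¹, fun x hx => ?_⟩
    have h0 : (1 / 2 : ℝ) ^ 2 - x ^ 2 ≠ 0 := by
      have := hx 0
      norm_num at this ⊢
      exact fun h => this (by linarith)
    have hrefl := Real.Gamma_mul_Gamma_one_sub (1 / 2 + x)
    rw [show 1 - (1 / 2 + x) = 1 / 2 - x by ring,
      show π * (1 / 2 + x) = π * x + π / 2 by ring, Real.sin_add_pi_div_two] at hrefl
    rw [show ((0 : ℕ) : ℝ) + 1 + 1 / 2 = 1 / 2 + 1 by norm_num, step _ _ h0, hrefl,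
      div_eq_iff h0, ← cosPowTransform_one, inv_div]
    ring
  | succ N ih =>
    obtain ⟨c, hc⟩ := ih
    refine ⟨c * (4 / ((((2 * N + 1 : ℕ) : ℝ) + 2) * (((2 * N + 1 : ℕ) : ℝ) + 1))), fun x hx => ?_⟩
    have h0 : ((N : ℝ) + 1 + 1 / 2) ^ 2 - x ^ 2 ≠ 0 := by
      have := hx (N + 1)
      push_cast at this
      exact fun h => this (by linarith)
    have hrec := cosPowTransform_add_two (2 * N + 1) x
    rw [show ((N + 1 : ℕ) : ℝ) + 1 + 1 / 2 = ((N : ℝ) + 1 + 1 / 2) + 1 by push_cast; ring,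
      step _ _ h0, hc x hx, show 2 * (N + 1) + 1 = 2 * N + 1 + 2 by ring, div_eq_iff h0]
    have e : (((2 * N + 1 : ℕ) : ℝ) + 2) / 2 = (N : ℝ) + 1 + 1 / 2 := by push_cast; ring
    rw [e] at hrec
    have h1 : (((2 * N + 1 : ℕ) : ℝ) + 2) ≠ 0 := by positivity
    have h2 : (((2 * N + 1 : ℕ) : ℝ) + 1) ≠ 0 := by positivity
    generalize ((2 * N + 1 : ℕ) : ℝ) = q at *
    have h4 : cosPowTransform (2 * N + 1) x = 4 / ((q + 2) * (q + 1))
        * ((((N : ℝ) + 1 + 1 / 2) ^ 2 - x ^ 2) * cosPowTransform (2 * N + 1 + 2) x) := by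
      rw [hrec]
      field_simp
    linear_combination c * h4

lemma ae_sq_ne_half_int_sq : ∀ᵐ x : ℝ, ∀ k : ℕ, x ^ 2 ≠ ((k : ℝ) + 1 / 2) ^ 2 := by
  rw [ae_all_iff]
  intro k
  have hfin : ({x : ℝ | x ^ 2 = ((k : ℝ) + 1 / 2) ^ 2}).Finite := by
    refine (Set.toFinite {(k : ℝ) + 1 / 2, -((k : ℝ) + 1 / 2)}).subset fun x hx => ?_
    exact sq_eq_sq_iff_eq_or_eq_neg.1 hx
  rw [ae_iff]
  simpa using hfin.measure_zero volume

lemma Gamma_nat_add_half_eq_prod (N : ℕ) :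
    Real.Gamma ((N : ℝ) + 1 / 2)
      = (∏ k ∈ Finset.Icc 1 N, (2 * (k : ℝ) - 1)) * √π / 2 ^ N := by
  induction N with
  | zero => simpa using Real.Gamma_one_half_eq
  | succ N ih =>
    rw [show ((N + 1 : ℕ) : ℝ) + 1 / 2 = ((N : ℝ) + 1 / 2) + 1 by push_cast; ring,
      Real.Gamma_add_one (by positivity), ih, Finset.prod_Icc_succ_top (by omega)]
    push_cast
    field_simp
    ring

lemma intervalIntegral_swap_of_continuous {f : ℝ → ℝ → ℝ} (hf : Continuous (Function.uncurry f))
    {a b c d : ℝ} (hab : a ≤ b) (hcd : c ≤ d) :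
    ∫ x in a..b, ∫ t in c..d, f x t = ∫ t in c..d, ∫ x in a..b, f x t := by
  simp only [intervalIntegral.integral_of_le hab, intervalIntegral.integral_of_le hcd]
  refine integral_integral_swap ?_
  rw [Measure.prod_restrict]
  exact (hf.continuousOn.integrableOn_compact (isCompact_Icc.prod isCompact_Icc)).mono_set
    (Set.prod_mono Set.Ioc_subset_Icc_self Set.Ioc_subset_Icc_self)

lemma iteratedDeriv_polynomial_eval (p : Polynomial ℝ) {d : ℕ} (hp : p.natDegree ≤ d) (t : ℝ) :
    iteratedDeriv d (fun t => p.eval t) t = d.factorial * p.coeff d := by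
  have h : ∀ j : ℕ, iteratedDeriv j (fun t => p.eval t)
      = fun t => (Polynomial.derivative^[j] p).eval t := by
    intro j
    induction j with
    | zero => simp
    | succ j ih =>
      rw [iteratedDeriv_succ, ih]
      funext t
      rw [Polynomial.deriv, Function.iterate_succ_apply']
  rw [h]
  have hdeg : (Polynomial.derivative^[d] p).natDegree = 0 := by
    have := Polynomial.natDegree_iterate_derivative p d
    omega
  rw [Polynomial.eq_C_of_natDegree_eq_zero hdeg]
  simp [Polynomial.coeff_iterate_derivative, Nat.descFactorial_self]

lemma integrableOn_besselJ_mul_cosPowTransform (m N : ℕ) (hmN : m ≤ N) {lam : ℝ}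
    (hlam : 0 < lam) :
    IntegrableOn (fun x : ℝ => x ^ (2 * m + 1) * besselJ (2 * m + 2) (lam * x)
      * cosPowTransform (2 * N + 1) x) (Set.Ioi 0) := by
  have hJ := continuous_besselJ (2 * m + 2)
  have hG := continuous_cosPowTransform (2 * N + 1)
  have hcont : Continuous fun x : ℝ => x ^ (2 * m + 1) * besselJ (2 * m + 2) (lam * x)
      * cosPowTransform (2 * N + 1) x := by fun_prop
  obtain ⟨C₁, hC₁⟩ := exists_abs_besselJ_le (2 * m + 2)
  obtain ⟨C₂, hC₂⟩ := exists_cosPowTransform_decay N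
  have hO : (fun x : ℝ => x ^ (2 * m + 1) * besselJ (2 * m + 2) (lam * x)
      * cosPowTransform (2 * N + 1) x) =O[atTop] fun x : ℝ => x ^ (-(3 / 2) : ℝ) := by
    refine Asymptotics.IsBigO.of_bound (C₁ * lam ^ (-(1 / 2) : ℝ) * C₂) ?_
    filter_upwards [hC₂, eventually_ge_atTop 1, eventually_ge_atTop (1 / lam)] with x h2 hx hxl
    have hx0 : 0 < x := by positivity
    have h1 := hC₁ (lam * x) (by rw [div_le_iff₀ hlam] at hxl; linarith)
    have hpow : x ^ (2 * m + 2) ≤ x ^ (2 * N + 2) := pow_le_pow_right₀ hx (by omega)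
    have h3 : |cosPowTransform (2 * N + 1) x| * x ^ (2 * m + 2) ≤ C₂ :=
      (mul_le_mul_of_nonneg_left hpow (abs_nonneg _)).trans h2
    have hr : x ^ (-(3 / 2) : ℝ) = x ^ (-(1 / 2) : ℝ) / x := by
      rw [show (-(3 / 2) : ℝ) = -(1 / 2) - 1 by norm_num, Real.rpow_sub_one hx0.ne']
    rw [Real.mul_rpow hlam.le hx0.le] at h1
    rw [Real.norm_eq_abs, abs_mul, abs_mul, abs_of_pos (by positivity : 0 < x ^ (2 * m + 1)),
      Real.norm_eq_abs, abs_of_nonneg (Real.rpow_nonneg hx0.le _), hr]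
    calc x ^ (2 * m + 1) * |besselJ (2 * m + 2) (lam * x)| * |cosPowTransform (2 * N + 1) x|
        = |besselJ (2 * m + 2) (lam * x)|
            * (|cosPowTransform (2 * N + 1) x| * x ^ (2 * m + 2)) / x := by
          field_simp
          ring
      _ ≤ C₁ * (lam ^ (-(1 / 2) : ℝ) * x ^ (-(1 / 2) : ℝ)) * C₂ / x := by
          gcongr
          exact (abs_nonneg _).trans h1
      _ = _ := by ring
  exact ((hcont.locallyIntegrable.locallyIntegrableOn _).integrableOn_of_isBigO_atTop hO
    (integrableAtFilter_rpow_atTop_iff.2 (by norm_num))).mono_set Set.Ioi_subset_Ici_self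

lemma integral_iteratedDeriv_cos_half_pow_mul_sin (m q : ℕ) (hq : 2 * m + 1 ≤ q) (x : ℝ) :
    ∫ t in (-π)..π, iteratedDeriv (2 * m + 1) (fun t : ℝ => Real.cos (t / 2) ^ q) t
        * Real.sin (x * t)
      = -((-1) ^ m * x ^ (2 * m + 1) * cosPowTransform q x) := by
  have hφ : ContDiff ℝ ∞ fun t : ℝ => Real.cos (t / 2) ^ q :=
    (Real.contDiff_cos.comp (contDiff_id.div_const 2)).pow q
  have hf : ContDiff ℝ ∞ fun t : ℝ => Real.sin (x * t) :=
    Real.contDiff_sin.comp (contDiff_const.mul contDiff_id)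
  rw [integral_iteratedDeriv_mul hφ hf _ fun j hj => iteratedDeriv_cos_half_pow_pi q (by omega),
    iteratedDeriv_comp_const_mul Real.contDiff_sin, Real.iteratedDeriv_odd_sin, cosPowTransform,
    ← intervalIntegral.integral_const_mul, ← intervalIntegral.integral_const_mul,
    ← intervalIntegral.integral_neg]
  refine intervalIntegral.integral_congr fun t _ => ?_
  simp [pow_succ, pow_mul]
  ring

lemma integral_iteratedDeriv_cos_half_pow_mul_besselPoly (m q : ℕ) (hq : 2 * m + 1 ≤ q) (c : ℝ) :
    ∫ t in (-π)..π, iteratedDeriv (2 * m + 1) (fun t : ℝ => Real.cos (t / 2) ^ q) t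
        * (besselPoly m).2.eval (c * t)
      = -((-1) ^ m * (c ^ (2 * m + 1) * (2 * m + 1).factorial * 2 ^ (2 * m + 1))
          * cosPowTransform q 0) := by
  have hφ : ContDiff ℝ ∞ fun t : ℝ => Real.cos (t / 2) ^ q :=
    (Real.contDiff_cos.comp (contDiff_id.div_const 2)).pow q
  have hp {k : WithTop ℕ∞} : ContDiff ℝ k fun t : ℝ => (besselPoly m).2.eval t :=
    by simpa using (besselPoly m).2.contDiff_aeval (𝕜 := ℝ) k
  have hf : ContDiff ℝ ∞ fun t : ℝ => (besselPoly m).2.eval (c * t) :=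
    hp.comp (contDiff_const.mul contDiff_id)
  rw [integral_iteratedDeriv_mul hφ hf _ fun j hj => iteratedDeriv_cos_half_pow_pi q (by omega),
    iteratedDeriv_comp_const_mul (f := fun t : ℝ => (besselPoly m).2.eval t) hp, cosPowTransform,
    ← intervalIntegral.integral_const_mul, ← intervalIntegral.integral_const_mul,
    ← intervalIntegral.integral_neg]
  refine intervalIntegral.integral_congr fun t _ => ?_
  simp only [iteratedDeriv_polynomial_eval _ (natDegree_besselPoly_le m).2, (coeff_besselPoly m).2]
  simp [pow_succ, pow_mul]
  ring

lemma integral_besselJ_mul_cosPowTransform (m N : ℕ) (hmN : m ≤ N) {lam : ℝ} (hlam : π < lam) :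
    ∫ x in Set.Ioi (0 : ℝ), x ^ (2 * m + 1) * besselJ (2 * m + 2) (lam * x)
        * cosPowTransform (2 * N + 1) x
      = (2 * m + 1).factorial * 2 ^ (2 * m + 1) / lam ^ (2 * m + 2)
        * cosPowTransform (2 * N + 1) 0 := by
  have hlam0 : 0 < lam := Real.pi_pos.trans hlam
  set q := 2 * N + 1 with hq
  set ψ : ℝ → ℝ := iteratedDeriv (2 * m + 1) fun t : ℝ => Real.cos (t / 2) ^ q with hψ
  have hφ : ContDiff ℝ ∞ fun t : ℝ => Real.cos (t / 2) ^ q :=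
    (Real.contDiff_cos.comp (contDiff_id.div_const 2)).pow q
  have hψc : Continuous ψ :=
    hφ.continuous_iteratedDeriv (2 * m + 1)
      (WithTop.coe_le_coe.2 (le_top (a := ((2 * m + 1 : ℕ) : ℕ∞))))
  have hJ := continuous_besselJ (2 * m + 2)
  have hlim := intervalIntegral_tendsto_integral_Ioi 0
    (integrableOn_besselJ_mul_cosPowTransform m N hmN hlam0) tendsto_id
  refine tendsto_nhds_unique hlim ?_
  have hscale : ∀ R t : ℝ, ∫ x in (0 : ℝ)..R, besselJ (2 * m + 2) (lam * x) * Real.sin (x * t)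
      = lam⁻¹ * besselSin (2 * m + 2) (lam * R) (lam⁻¹ * t) := by
    intro R t
    have h := intervalIntegral.integral_comp_mul_left (a := 0) (b := R)
      (fun y => besselJ (2 * m + 2) y * Real.sin (y * (lam⁻¹ * t))) hlam0.ne'
    rw [mul_zero, smul_eq_mul] at h
    rw [besselSin, ← h]
    refine intervalIntegral.integral_congr fun x _ => ?_
    have : lam * x * (lam⁻¹ * t) = x * t := by field_simp
    simp only [this]
  have hswap : ∀ R : ℝ, 0 ≤ R →
      -((-1) ^ m * lam⁻¹)
          * ∫ t in (-π)..π, ψ t * besselSin (2 * m + 2) (lam * R) (lam⁻¹ * t)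
        = ∫ x in (0 : ℝ)..R, x ^ (2 * m + 1) * besselJ (2 * m + 2) (lam * x)
            * cosPowTransform q x := by
    intro R hR
    have hsw := intervalIntegral_swap_of_continuous
      (f := fun x t => besselJ (2 * m + 2) (lam * x) * (ψ t * Real.sin (x * t)))
      (by unfold Function.uncurry; fun_prop) hR
      (by linarith [Real.pi_pos] : -π ≤ π)
    have hin : ∀ x : ℝ, ∫ t in (-π)..π, besselJ (2 * m + 2) (lam * x) * (ψ t * Real.sin (x * t))
        = -(-1) ^ m * (x ^ (2 * m + 1) * besselJ (2 * m + 2) (lam * x) * cosPowTransform q x) := by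
      intro x
      rw [intervalIntegral.integral_const_mul, hψ,
        integral_iteratedDeriv_cos_half_pow_mul_sin m q (by omega)]
      ring
    have hout : ∀ t : ℝ, ∫ x in (0 : ℝ)..R, besselJ (2 * m + 2) (lam * x) * (ψ t * Real.sin (x * t))
        = lam⁻¹ * (ψ t * besselSin (2 * m + 2) (lam * R) (lam⁻¹ * t)) := by
      intro t
      calc _ = ∫ x in (0 : ℝ)..R, ψ t * (besselJ (2 * m + 2) (lam * x) * Real.sin (x * t)) :=
            intervalIntegral.integral_congr fun x _ => by ring
        _ = _ := by rw [intervalIntegral.integral_const_mul, hscale]; ring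
    simp only [hin, hout, intervalIntegral.integral_const_mul] at hsw
    have hsign : ((-1 : ℝ) ^ m) * (-1) ^ m = 1 := by rw [← mul_pow]; simp
    linear_combination (-(-1) ^ m) * -hsw
      + (∫ x in (0 : ℝ)..R, x ^ (2 * m + 1) * besselJ (2 * m + 2) (lam * x)
            * cosPowTransform q x) * hsign
  have hτ : ∀ t ∈ Set.Icc (-π) π, lam⁻¹ * t ∈ Set.Icc (-(π / lam)) (π / lam) := by
    intro t ht
    have : |lam⁻¹ * t| ≤ π / lam := by
      rw [abs_mul, abs_of_pos (inv_pos.2 hlam0), div_eq_inv_mul]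
      exact mul_le_mul_of_nonneg_left (abs_le.2 ht) (inv_pos.2 hlam0).le
    exact abs_le.1 this
  have hunif : TendstoUniformlyOn
      (fun R u => besselSin (2 * m + 2) R u - (besselPoly m).2.eval u) (fun _ => 0) atTop
      (Set.Icc (-(π / lam)) (π / lam)) :=
    tendsto_prod_principal_iff.1 (tendsto_besselCos_besselSin (by positivity)
      ((div_lt_one hlam0).2 hlam) m).2
  have hatTop : Tendsto (fun R : ℝ => lam * R) atTop atTop := tendsto_id.const_mul_atTop hlam0
  have hpc : Continuous fun t : ℝ => (besselPoly m).2.eval (lam⁻¹ * t) :=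
    (besselPoly m).2.continuous.comp (by fun_prop)
  have hSc : ∀ R, Continuous fun t : ℝ => besselSin (2 * m + 2) R (lam⁻¹ * t) := fun R =>
    (continuous_iff_continuousAt.2 fun t =>
      (hasDerivAt_besselSin (2 * m + 2) R t).continuousAt).comp (by fun_prop)
  have hmain : Tendsto (fun R : ℝ => ∫ t in (-π)..π,
      ψ t * besselSin (2 * m + 2) (lam * R) (lam⁻¹ * t)) atTop
      (𝓝 (∫ t in (-π)..π, ψ t * (besselPoly m).2.eval (lam⁻¹ * t))) := by
    refine intervalIntegral.tendsto_integral_filter_of_dominated_convergence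
      (fun t => |ψ t| * (1 + |(besselPoly m).2.eval (lam⁻¹ * t)|))
      (Eventually.of_forall fun R => (hψc.mul (hSc _)).aestronglyMeasurable) ?_
      (Continuous.intervalIntegrable (by fun_prop) _ _) ?_
    · have hev := hatTop.eventually (Metric.tendstoUniformlyOn_iff.1 hunif 1 one_pos)
      filter_upwards [hev] with R hR
      refine Eventually.of_forall fun t ht => ?_
      rw [Set.uIoc_of_le (by linarith [Real.pi_pos])] at ht
      have h := hR _ (hτ t (Set.Ioc_subset_Icc_self ht))
      rw [dist_zero_left, Real.norm_eq_abs] at h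
      rw [norm_mul, Real.norm_eq_abs, Real.norm_eq_abs]
      gcongr
      have := abs_add_le (besselSin (2 * m + 2) (lam * R) (lam⁻¹ * t)
        - (besselPoly m).2.eval (lam⁻¹ * t)) ((besselPoly m).2.eval (lam⁻¹ * t))
      rw [sub_add_cancel] at this
      linarith
    · refine Eventually.of_forall fun t ht => ?_
      rw [Set.uIoc_of_le (by linarith [Real.pi_pos])] at ht
      have h := (hunif.tendsto_at (hτ t (Set.Ioc_subset_Icc_self ht))).comp hatTop
      have h' := h.add_const ((besselPoly m).2.eval (lam⁻¹ * t))
      simp only [Function.comp_def, sub_add_cancel, zero_add] at h'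
      exact h'.const_mul _
  have hfin := hmain.const_mul (-((-1) ^ m * lam⁻¹))
  have hval : -((-1) ^ m * lam⁻¹) * ∫ t in (-π)..π, ψ t * (besselPoly m).2.eval (lam⁻¹ * t)
      = (2 * m + 1).factorial * 2 ^ (2 * m + 1) / lam ^ (2 * m + 2) * cosPowTransform q 0 := by
    rw [hψ, integral_iteratedDeriv_cos_half_pow_mul_besselPoly m q (by omega)]
    have hsign : ((-1 : ℝ) ^ m) * (-1) ^ m = 1 := by rw [← mul_pow]; simp
    have hp : lam⁻¹ * lam⁻¹ ^ (2 * m + 1) = (lam ^ (2 * m + 2))⁻¹ := by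
      rw [← pow_succ', inv_pow]
    rw [div_eq_mul_inv, ← hp]
    linear_combination (lam⁻¹ * lam⁻¹ ^ (2 * m + 1) * (2 * m + 1).factorial * 2 ^ (2 * m + 1)
      * cosPowTransform q 0) * hsign
  rw [hval] at hfin
  refine hfin.congr' ?_
  filter_upwards [eventually_ge_atTop 0] with R hR using hswap R hR

theorem one_div_pi_identity_even_order
    (m n : ℕ) (hn : 1 ≤ n) (lam : ℝ) (hlam : π < lam) :
    1 / π = ((∏ k ∈ Finset.Icc 1 (m + n), (2 * (k : ℝ) - 1)) ^ 2 * lam ^ (2 * m + 2)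
              / ((Nat.factorial (2 * m + 1) : ℝ) * 2 ^ (4 * m + 2 * n + 1)))
        * ∫ x in Set.Ioi (0 : ℝ), x ^ (2 * m + 1) * besselJ (2 * m + 2) (lam * x)
            * (Real.Gamma ((m : ℝ) + n + 1 / 2 + x) * Real.Gamma ((m : ℝ) + n + 1 / 2 - x))⁻¹ := by
  obtain ⟨j, rfl⟩ : ∃ j, n = j + 1 := ⟨n - 1, by omega⟩
  have hlam0 : 0 < lam := Real.pi_pos.trans hlam
  have hcast : (m : ℝ) + ((j + 1 : ℕ) : ℝ) + 1 / 2 = ((m + j : ℕ) : ℝ) + 1 + 1 / 2 := by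
    push_cast; ring
  obtain ⟨c, hc⟩ := exists_inv_Gamma_mul_Gamma_eq (m + j)
  have hzero := hc 0 fun k => ne_of_lt (by rw [zero_pow two_ne_zero]; positivity)
  have hint : ∫ x in Set.Ioi (0 : ℝ), x ^ (2 * m + 1) * besselJ (2 * m + 2) (lam * x)
      * (Real.Gamma ((m : ℝ) + ((j + 1 : ℕ) : ℝ) + 1 / 2 + x)
        * Real.Gamma ((m : ℝ) + ((j + 1 : ℕ) : ℝ) + 1 / 2 - x))⁻¹
      = c * ∫ x in Set.Ioi (0 : ℝ), x ^ (2 * m + 1) * besselJ (2 * m + 2) (lam * x)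
          * cosPowTransform (2 * (m + j) + 1) x := by
    rw [← integral_const_mul]
    refine integral_congr_ae (ae_restrict_of_ae ?_)
    filter_upwards [ae_sq_ne_half_int_sq] with x hx
    rw [hcast, hc x hx]
    ring
  rw [hint, integral_besselJ_mul_cosPowTransform m (m + j) (by omega) hlam,
    mul_left_comm c, ← hzero, add_zero, sub_zero]
  have hG := Gamma_nat_add_half_eq_prod (m + (j + 1))
  rw [show ((m + (j + 1) : ℕ) : ℝ) + 1 / 2 = ((m + j : ℕ) : ℝ) + 1 + 1 / 2 by push_cast; ring] at hG
  have hP : (∏ k ∈ Finset.Icc 1 (m + (j + 1)), (2 * (k : ℝ) - 1)) ≠ 0 := by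
    refine Finset.prod_ne_zero_iff.2 fun k hk => ?_
    have : (1 : ℝ) ≤ k := by exact_mod_cast (Finset.mem_Icc.1 hk).1
    linarith
  have hfac : ((2 * m + 1).factorial : ℝ) ≠ 0 := by exact_mod_cast Nat.factorial_ne_zero _
  rw [hG]
  have hpi := Real.pi_pos
  have hsq : √π ^ 2 = π := Real.sq_sqrt hpi.le
  have hs0 : √π ≠ 0 := (Real.sqrt_pos.2 hpi).ne'
  field_simp
  rw [hsq]
  ring
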